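/- arXiv:2311.01137 — 9 statements merged into one kernel-verified Lean document; each statement's English description precedes it below -/
import Mathlib

section
/- Let (X, d, α) be a controlled metric type space, let r ≥ 0, and let (x_n) be a sequence in X. Suppose k ≥ 1 is an upper bound for α, i.e. α(x,y) ≤ k for all x, y ∈ X. Then for any two rough limit points x, y ∈ LIM^r x_n one has d(x,y) ≤ 2rk; consequently the diameter of the rough limit set LIM^r x_n is at most 2rk. -/
/-- A controlled metric type space on a nonempty set `X`: a distance function `d`
taking values in `[0, ∞)` and a control function `α` taking values in `[1, ∞)`
satisfying the controlled triangle inequality. -/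
structure ControlledMetric (X : Type*) [Nonempty X] where
  d : X → X → ℝ
  α : X → X → ℝ
  d_nonneg : ∀ x y, 0 ≤ d x y
  one_le_α : ∀ x y, 1 ≤ α x y
  eq_iff : ∀ x y, d x y = 0 ↔ x = y
  symm : ∀ x y, d x y = d y x
  triangle : ∀ x y z, d x y ≤ α x z * d x z + α z y * d z y

/-- Rough convergence of a sequence `x` to `l` with roughness degree `r`. -/
def RoughConv {X : Type*} [Nonempty X] (M : ControlledMetric X) (r : ℝ)
    (x : ℕ → X) (l : X) : Prop :=
  ∀ ε : ℝ, 0 < ε → ∃ N : ℕ, ∀ n ≥ N, M.d (x n) l < r + ε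

/-- The rough limit set `LIM^r x_n`. -/
def RoughLimSet {X : Type*} [Nonempty X] (M : ControlledMetric X) (r : ℝ)
    (x : ℕ → X) : Set X :=
  {l | RoughConv M r x l}

/-- Any two rough limit points of the same sequence are at distance at most `2 * r * k`. -/
theorem RoughConv.dist_le {X : Type*} [Nonempty X] {M : ControlledMetric X} {r k : ℝ}
    (hk : 1 ≤ k) (hα : ∀ x y, M.α x y ≤ k) {xseq : ℕ → X} {x y : X}
    (hx : RoughConv M r xseq x) (hy : RoughConv M r xseq y) : M.d x y ≤ 2 * r * k := by
  have hk0 : 0 < k := by linarith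
  refine le_of_forall_pos_le_add fun ε hε => ?_
  have hδ : 0 < ε / (2 * k) := by positivity
  obtain ⟨N₁, hN₁⟩ := hx _ hδ
  obtain ⟨N₂, hN₂⟩ := hy _ hδ
  set z := xseq (max N₁ N₂)
  have hxz : M.d x z ≤ r + ε / (2 * k) :=
    M.symm x z ▸ (hN₁ _ (le_max_left _ _)).le
  have hzy : M.d z y ≤ r + ε / (2 * k) := (hN₂ _ (le_max_right _ _)).le
  calc M.d x y ≤ M.α x z * M.d x z + M.α z y * M.d z y := M.triangle x y z
    _ ≤ k * (r + ε / (2 * k)) + k * (r + ε / (2 * k)) :=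
        add_le_add (mul_le_mul (hα x z) hxz (M.d_nonneg x z) hk0.le)
          (mul_le_mul (hα z y) hzy (M.d_nonneg z y) hk0.le)
    _ = 2 * r * k + ε := by field_simp; ring

/-- If `k ≥ 1` bounds `α`, then any two rough limit points `x, y ∈ LIM^r x_n`
satisfy `d(x,y) ≤ 2rk`; consequently the diameter of `LIM^r x_n` is at most `2rk`. -/
theorem diam_roughLimSet_le {X : Type*} [Nonempty X] (M : ControlledMetric X)
    (r k : ℝ) (hr : 0 ≤ r) (hk : 1 ≤ k) (hα : ∀ x y, M.α x y ≤ k)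
    (xseq : ℕ → X) :
    (∀ x ∈ RoughLimSet M r xseq, ∀ y ∈ RoughLimSet M r xseq, M.d x y ≤ 2 * r * k) ∧
    sSup {t : ℝ | ∃ x ∈ RoughLimSet M r xseq, ∃ y ∈ RoughLimSet M r xseq, t = M.d x y}
      ≤ 2 * r * k := by
  have h : ∀ x ∈ RoughLimSet M r xseq, ∀ y ∈ RoughLimSet M r xseq, M.d x y ≤ 2 * r * k :=
    fun x hx y hy => RoughConv.dist_le hk hα hx hy
  refine ⟨h, Real.sSup_le ?_ (by positivity)⟩
  rintro _ ⟨x, hx, y, hy, rfl⟩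
  exact h x hx y hy
end

section
/- Let (X, d, α) be a controlled metric type space, let r ≥ 0, and let (x_n) be a sequence in X. If α is bounded above, i.e. there exists k ≥ 1 with α(x,y) ≤ k for all x, y ∈ X, then the rough limit set LIM^r x_n is a bounded set: there exists a real number B such that d(x,y) ≤ B for all x, y ∈ LIM^r x_n. -/
/-- If `α` is bounded above by some `k ≥ 1`, then the rough limit set
`LIM^r x_n` is a bounded set. -/
theorem roughLimSet_bounded {X : Type*} [Nonempty X] (M : ControlledMetric X)
    (r : ℝ) (hr : 0 ≤ r) (xseq : ℕ → X)
    (h : ∃ k : ℝ, 1 ≤ k ∧ ∀ x y, M.α x y ≤ k) :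
    ∃ B : ℝ, ∀ x ∈ RoughLimSet M r xseq, ∀ y ∈ RoughLimSet M r xseq, M.d x y ≤ B := by
  obtain ⟨k, hk, hα⟩ := h
  refine ⟨k * (r + 1) + k * (r + 1), fun x hx y hy => ?_⟩
  obtain ⟨N₁, h₁⟩ := hx 1 one_pos
  obtain ⟨N₂, h₂⟩ := hy 1 one_pos
  let z := xseq (max N₁ N₂)
  have hxz : M.d x z ≤ r + 1 := M.symm x z ▸ (h₁ _ (le_max_left N₁ N₂)).le
  have hzy : M.d z y ≤ r + 1 := (h₂ _ (le_max_right N₁ N₂)).le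
  have hk₀ : 0 ≤ k := zero_le_one.trans hk
  calc
    M.d x y ≤ M.α x z * M.d x z + M.α z y * M.d z y := M.triangle x y z
    _ ≤ k * (r + 1) + k * (r + 1) :=
      add_le_add (mul_le_mul (hα x z) hxz (M.d_nonneg x z) hk₀)
        (mul_le_mul (hα z y) hzy (M.d_nonneg z y) hk₀)
end

section
/- Let (X, d, α) be a controlled metric type space, let r ≥ 0, and suppose k ≥ 1 satisfies α(x,y) ≤ k for all x, y ∈ X. If a sequence (x_n) in X converges to x (i.e., for every ε > 0 there is N with d(x_n, x) < ε for all n ≥ N), then the closed ball B̄(x, r) = {y ∈ X : d(x,y) ≤ r} is contained in the rough limit set LIM^{rk} x_n. -/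
/-- If `x_n → x` and `α ≤ k`, then the closed ball `B̄(x, r)` is contained
in `LIM^{rk} x_n`. -/
theorem closedBall_subset_roughLimSet {X : Type*} [Nonempty X] (M : ControlledMetric X)
    (r k : ℝ) (hr : 0 ≤ r) (hk : 1 ≤ k) (hα : ∀ x y, M.α x y ≤ k)
    (xseq : ℕ → X) (x : X)
    (hconv : ∀ ε : ℝ, 0 < ε → ∃ N : ℕ, ∀ n ≥ N, M.d (xseq n) x < ε) :
    {y : X | M.d x y ≤ r} ⊆ RoughLimSet M (r * k) xseq := by
  intro y (hy : M.d x y ≤ r) ε hε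
  have hk0 : 0 < k := by linarith
  obtain ⟨N, hN⟩ := hconv (ε / k) (div_pos hε hk0)
  refine ⟨N, fun n hn => ?_⟩
  calc M.d (xseq n) y
      ≤ M.α (xseq n) x * M.d (xseq n) x + M.α x y * M.d x y := M.triangle _ _ _
    _ ≤ k * M.d (xseq n) x + k * r :=
        add_le_add (mul_le_mul_of_nonneg_right (hα _ _) (M.d_nonneg _ _))
          (mul_le_mul (hα _ _) hy (M.d_nonneg _ _) hk0.le)
    _ < k * (ε / k) + k * r := by gcongr; exact hN n hn
    _ = r * k + ε := by rw [mul_div_cancel₀ _ hk0.ne']; ring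
end

section
/- Let (X, d, α) be a controlled metric type space, let r ≥ 0, and suppose k ≥ 1 satisfies α(x,y) ≤ k for all x, y ∈ X. If a sequence (x_n) in X converges to x (i.e., for every ε > 0 there is N with d(x_n, x) < ε for all n ≥ N), then the rough limit set LIM^r x_n is contained in the closed ball B̄(x, rk) = {z ∈ X : d(x,z) ≤ rk}. -/
/-- If `x_n → x` and `α ≤ k`, then `LIM^r x_n ⊆ B̄(x, rk)`. -/
theorem roughLimSet_subset_closedBall {X : Type*} [Nonempty X] (M : ControlledMetric X)
    (r k : ℝ) (hr : 0 ≤ r) (hk : 1 ≤ k) (hα : ∀ x y, M.α x y ≤ k)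
    (xseq : ℕ → X) (x : X)
    (hconv : ∀ ε : ℝ, 0 < ε → ∃ N : ℕ, ∀ n ≥ N, M.d (xseq n) x < ε) :
    RoughLimSet M r xseq ⊆ {z : X | M.d x z ≤ r * k} := by
  intro z hz
  rw [Set.mem_ofPred_eq]
  refine le_of_forall_pos_le_add fun ε hε => ?_
  have hδ : 0 < ε / (2 * k) := by positivity
  obtain ⟨N₁, h₁⟩ := hconv _ hδ
  obtain ⟨N₂, h₂⟩ := hz _ hδ
  have hx := h₁ _ (le_max_left N₁ N₂)
  have hz' := h₂ _ (le_max_right N₁ N₂)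
  set y := xseq (max N₁ N₂)
  calc M.d x z ≤ M.α x y * M.d x y + M.α y z * M.d y z := M.triangle x z y
    _ ≤ k * M.d y x + k * M.d y z := by
      rw [M.symm x y]
      exact add_le_add (mul_le_mul_of_nonneg_right (hα _ _) (M.d_nonneg _ _))
        (mul_le_mul_of_nonneg_right (hα _ _) (M.d_nonneg _ _))
    _ ≤ k * (ε / (2 * k)) + k * (r + ε / (2 * k)) := by gcongr
    _ = r * k + ε := by field_simp; ring
end

section
/- Let (X, d, α) be a controlled metric type space, let r ≥ 0, let (x_n) be a sequence in X, and suppose k ≥ 1 satisfies α(x,y) ≤ k for all x, y ∈ X. If y ∈ X is a limit point of the set LIM^r x_n, in the sense that there exists a sequence (y_n) with each y_n ∈ LIM^r x_n and d(y_n, y) → 0 as n → ∞, then y ∈ LIM^{rk} x_n. That is, the set of limit points of LIM^r x_n is contained in LIM^{rk} x_n. -/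
/-- If `α ≤ k` and `y` is a limit point of `LIM^r x_n` (there is a sequence
`y_n ∈ LIM^r x_n` with `d(y_n, y) → 0`), then `y ∈ LIM^{rk} x_n`. -/
theorem limitPoints_roughLimSet_subset {X : Type*} [Nonempty X] (M : ControlledMetric X)
    (r k : ℝ) (hr : 0 ≤ r) (hk : 1 ≤ k) (hα : ∀ x y, M.α x y ≤ k)
    (xseq : ℕ → X) (y : X) (yseq : ℕ → X)
    (hmem : ∀ n, yseq n ∈ RoughLimSet M r xseq)
    (hconv : ∀ ε : ℝ, 0 < ε → ∃ N : ℕ, ∀ n ≥ N, M.d (yseq n) y < ε) :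
    y ∈ RoughLimSet M (r * k) xseq := by
  intro ε hε
  have hk0 : 0 < k := zero_lt_one.trans_le hk
  have hδ : 0 < ε / (2 * k) := by positivity
  obtain ⟨m, hm⟩ := hconv _ hδ
  obtain ⟨N, hN⟩ := hmem m _ hδ
  refine ⟨N, fun n hn => ?_⟩
  calc M.d (xseq n) y
      ≤ M.α (xseq n) (yseq m) * M.d (xseq n) (yseq m) + M.α (yseq m) y * M.d (yseq m) y :=
        M.triangle _ _ _
    _ ≤ k * M.d (xseq n) (yseq m) + k * M.d (yseq m) y :=
        add_le_add (mul_le_mul_of_nonneg_right (hα _ _) (M.d_nonneg _ _))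
          (mul_le_mul_of_nonneg_right (hα _ _) (M.d_nonneg _ _))
    _ < k * (r + ε / (2 * k)) + k * (ε / (2 * k)) :=
        add_lt_add (mul_lt_mul_of_pos_left (hN n hn) hk0)
          (mul_lt_mul_of_pos_left (hm m le_rfl) hk0)
    _ = r * k + ε := by
        field_simp
        ring
end

section
/- Let (X, d, α) be a controlled metric type space, let r ≥ 0, and suppose k ≥ 1 satisfies α(x,y) ≤ k for all x, y ∈ X. If a sequence (x_n) in X r-converges to some x ∈ X, then (x_n) is bounded: there exists a real number B > 0 such that d(x_n, x_m) < B for all n, m ∈ ℕ. -/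
/-- If `α ≤ k` and `(x_n)` r-converges to some `x`, then `(x_n)` is bounded. -/
theorem roughConv_bounded {X : Type*} [Nonempty X] (M : ControlledMetric X)
    (r k : ℝ) (hr : 0 ≤ r) (hk : 1 ≤ k) (hα : ∀ x y, M.α x y ≤ k)
    (xseq : ℕ → X) (x : X) (hconv : RoughConv M r xseq x) :
    ∃ B : ℝ, 0 < B ∧ ∀ n m : ℕ, M.d (xseq n) (xseq m) < B := by
  obtain ⟨N, hN⟩ := hconv 1 one_pos
  obtain ⟨C, hC⟩ := ((Finset.range N).image fun n => M.d (xseq n) x).bddAbove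
  have hR : ∀ n, M.d (xseq n) x ≤ max C (r + 1) := fun n => by
    rcases lt_or_ge n N with h | h
    · exact le_max_of_le_left
        (hC (Finset.mem_coe.2 (Finset.mem_image_of_mem _ (Finset.mem_range.2 h))))
    · exact le_max_of_le_right (hN n h).le
  have hR0 : 0 < max C (r + 1) := lt_max_of_lt_right (by linarith)
  refine ⟨k * max C (r + 1) + k * max C (r + 1) + 1, by positivity, fun n m => ?_⟩
  have h₁ : M.α (xseq n) x * M.d (xseq n) x ≤ k * max C (r + 1) :=
    mul_le_mul (hα _ _) (hR n) (M.d_nonneg _ _) (by linarith)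
  have h₂ : M.α x (xseq m) * M.d x (xseq m) ≤ k * max C (r + 1) :=
    mul_le_mul (hα _ _) (M.symm x _ ▸ hR m) (M.d_nonneg _ _) (by linarith)
  linarith [M.triangle (xseq n) (xseq m) x]
end

section
/- Let (X, d, α) be a controlled metric type space, suppose k ≥ 1 satisfies α(x,y) ≤ k for all x, y ∈ X, and let r > 0. Let (a_n) and (b_n) be sequences in X such that there exists p₁ ∈ ℕ with d(a_i, b_i) ≤ r/k for all i ≥ p₁. If (a_n) converges to ξ ∈ X (i.e., for every ε > 0 there is N with d(a_n, ξ) < ε for all n ≥ N), then (b_n) r-converges to ξ, i.e. ξ ∈ LIM^r b_n. -/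
/-- If `α ≤ k`, `r > 0`, `d(a_i, b_i) ≤ r/k` for all `i ≥ p₁`, and
`a_n → ξ`, then `(b_n)` r-converges to `ξ`. -/
theorem roughConv_of_close_sequences {X : Type*} [Nonempty X] (M : ControlledMetric X)
    (r k : ℝ) (hr : 0 < r) (hk : 1 ≤ k) (hα : ∀ x y, M.α x y ≤ k)
    (a b : ℕ → X) (p₁ : ℕ) (hclose : ∀ i ≥ p₁, M.d (a i) (b i) ≤ r / k)
    (ξ : X) (hconv : ∀ ε : ℝ, 0 < ε → ∃ N : ℕ, ∀ n ≥ N, M.d (a n) ξ < ε) :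
    ξ ∈ RoughLimSet M r b := by
  intro ε hε
  have hk0 : 0 < k := by linarith
  obtain ⟨N, hN⟩ := hconv (ε / k) (div_pos hε hk0)
  refine ⟨max N p₁, fun n hn => ?_⟩
  have hbound : M.d (b n) (a n) ≤ r / k :=
    M.symm (b n) (a n) ▸ hclose n (le_of_max_le_right hn)
  calc M.d (b n) ξ
      ≤ M.α (b n) (a n) * M.d (b n) (a n) + M.α (a n) ξ * M.d (a n) ξ := M.triangle _ _ _
    _ ≤ k * M.d (b n) (a n) + k * M.d (a n) ξ :=
        add_le_add (mul_le_mul_of_nonneg_right (hα _ _) (M.d_nonneg _ _))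
          (mul_le_mul_of_nonneg_right (hα _ _) (M.d_nonneg _ _))
    _ < k * (r / k) + k * (ε / k) :=
        add_lt_add_of_le_of_lt (mul_le_mul_of_nonneg_left hbound hk0.le)
          (mul_lt_mul_of_pos_left (hN n (le_of_max_le_left hn)) hk0)
    _ = r + ε := by field_simp
end

section
/- Let (X, d, α) be a controlled metric type space, let r ≥ 0, and suppose k ≥ 1 satisfies α(x,y) ≤ k for all x, y ∈ X. Let (x_n) be a sequence in X that r-converges to some x ∈ X. If (ξ_n) is a sequence with each ξ_n ∈ LIM^r x_n and (ξ_n) converges to ξ ∈ X (i.e., d(ξ_n, ξ) → 0), then (x_n) rk-converges to ξ, i.e. ξ ∈ LIM^{rk} x_n. -/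
/-- If `α ≤ k`, `(x_n)` r-converges to `x`, and `(ξ_n)` is a sequence in
`LIM^r x_n` converging to `ξ`, then `(x_n)` rk-converges to `ξ`. -/
theorem roughConv_of_limit_of_roughLimSet {X : Type*} [Nonempty X] (M : ControlledMetric X)
    (r k : ℝ) (hr : 0 ≤ r) (hk : 1 ≤ k) (hα : ∀ x y, M.α x y ≤ k)
    (xseq : ℕ → X) (x : X) (hx : RoughConv M r xseq x)
    (ξseq : ℕ → X) (ξ : X) (hmem : ∀ n, ξseq n ∈ RoughLimSet M r xseq)
    (hξ : ∀ ε : ℝ, 0 < ε → ∃ N : ℕ, ∀ n ≥ N, M.d (ξseq n) ξ < ε) :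
    ξ ∈ RoughLimSet M (r * k) xseq := by
  intro ε hε
  have hk0 : 0 < k := by linarith
  have hδ : 0 < ε / (2 * k) := by positivity
  obtain ⟨m, hm⟩ := hξ _ hδ
  obtain ⟨N, hN⟩ := hmem m _ hδ
  refine ⟨N, fun n hn => ?_⟩
  calc M.d (xseq n) ξ
      ≤ M.α (xseq n) (ξseq m) * M.d (xseq n) (ξseq m) + M.α (ξseq m) ξ * M.d (ξseq m) ξ :=
        M.triangle _ _ _
    _ ≤ k * M.d (xseq n) (ξseq m) + k * M.d (ξseq m) ξ :=
        add_le_add (mul_le_mul_of_nonneg_right (hα _ _) (M.d_nonneg _ _))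
          (mul_le_mul_of_nonneg_right (hα _ _) (M.d_nonneg _ _))
    _ < k * (r + ε / (2 * k)) + k * (ε / (2 * k)) :=
        add_lt_add (mul_lt_mul_of_pos_left (hN n hn) hk0)
          (mul_lt_mul_of_pos_left (hm m le_rfl) hk0)
    _ = r * k + ε := by
        field_simp
        ring
end

section
/- Let (X, d, α) be a controlled metric type space, let r ≥ 0, and suppose k ≥ 1 satisfies α(x,y) ≤ k for all x, y ∈ X. Let (x_n) be a sequence in X and let c ∈ X be a cluster point of (x_n), i.e. for every ε > 0 and every p ∈ ℕ there exists m > p with d(x_m, c) < ε. Then LIM^r x_n ⊆ B̄(c, rk), i.e. every rough limit point x of (x_n) with roughness degree r satisfies d(x, c) ≤ rk. -/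
/-- If `α ≤ k` and `c` is a cluster point of `(x_n)`, then
`LIM^r x_n ⊆ B̄(c, rk)`. -/
theorem roughLimSet_subset_closedBall_clusterPoint {X : Type*} [Nonempty X]
    (M : ControlledMetric X) (r k : ℝ) (hr : 0 ≤ r) (hk : 1 ≤ k)
    (hα : ∀ x y, M.α x y ≤ k) (xseq : ℕ → X) (c : X)
    (hc : ∀ ε : ℝ, 0 < ε → ∀ p : ℕ, ∃ m > p, M.d (xseq m) c < ε) :
    RoughLimSet M r xseq ⊆ {y : X | M.d c y ≤ r * k} := by
  intro l hl
  have hk0 : 0 < k := one_pos.trans_le hk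
  refine le_of_forall_pos_le_add (a := M.d c l) fun ε hε => ?_
  have hδ : 0 < ε / (2 * k) := by positivity
  obtain ⟨N, hN⟩ := hl _ hδ
  obtain ⟨m, hm, hmc⟩ := hc _ hδ N
  have hml := hN m hm.le
  rw [M.symm] at hmc
  calc M.d c l ≤ M.α c (xseq m) * M.d c (xseq m) + M.α (xseq m) l * M.d (xseq m) l :=
        M.triangle c l (xseq m)
    _ ≤ k * M.d c (xseq m) + k * M.d (xseq m) l :=
        add_le_add (mul_le_mul_of_nonneg_right (hα _ _) (M.d_nonneg _ _))
          (mul_le_mul_of_nonneg_right (hα _ _) (M.d_nonneg _ _))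
    _ ≤ k * (ε / (2 * k)) + k * (r + ε / (2 * k)) := by gcongr
    _ = r * k + ε := by field_simp; ring
end
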